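/- arXiv:1607.04819 — 11 statements merged into one kernel-verified Lean document; each statement's English description precedes it below -/
import Mathlib

section
/- Let V be a finite set with |V| ≥ 2 and H a polymatroid rank function on V. Then the linear program min{ r(V) : r ∈ R_CO(V) } attains its minimum, and its minimum value equals max over partitions P of V with |P| ≥ 2 of Σ_{X∈P} (H(V) − H(X)) / (|P| − 1). (That is, R_ACO(V), the minimum sum-rate for the asymptotic CO problem, is given by the partition formula.) -/
open Finset

/-- `H` is a polymatroid rank function on the ground set `V`: normalized, monotone
and submodular. -/
def IsPolymatroid {V : Type*} [Fintype V] [DecidableEq V] (H : Finset V → ℝ) : Prop :=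
  H ∅ = 0 ∧ (∀ ⦃X Y : Finset V⦄, Y ⊆ X → H Y ≤ H X) ∧
    ∀ X Y : Finset V, H (X ∩ Y) + H (X ∪ Y) ≤ H X + H Y

/-- `P` is a partition of `W`: nonempty pairwise disjoint blocks whose union is `W`. -/
def IsPartitionOf {V : Type*} [DecidableEq V] (W : Finset V) (P : Finset (Finset V)) : Prop :=
  (∀ X ∈ P, X.Nonempty) ∧ (∀ X ∈ P, ∀ Y ∈ P, X ≠ Y → Disjoint X Y) ∧ P.biUnion id = W

/-- `r ∈ R_CO(V)`: the Slepian–Wolf constraints `r(X) ≥ H(V) - H(V \ X)` for all proper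
subsets `X ⊊ V`. -/
def MemRCO {V : Type*} [Fintype V] [DecidableEq V] (H : Finset V → ℝ) (r : V → ℝ) : Prop :=
  ∀ X : Finset V, X ⊂ Finset.univ → H Finset.univ - H (Finset.univ \ X) ≤ ∑ i ∈ X, r i

/-- The quantity `Σ_{X ∈ P} (H(V) - H(X)) / (|P| - 1)` associated with a partition `P`. -/
noncomputable def partitionRate {V : Type*} [Fintype V] (H : Finset V → ℝ)
    (P : Finset (Finset V)) : ℝ :=
  ∑ X ∈ P, (H Finset.univ - H X) / ((P.card : ℝ) - 1)

/-- The set of values `Σ_{X ∈ P} (H(V) - H(X)) / (|P| - 1)` over partitions `P` of `V`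
with at least two blocks; its maximum is `R_ACO(V)`. -/
def RACOSet {V : Type*} [Fintype V] [DecidableEq V] (H : Finset V → ℝ) : Set ℝ :=
  {t | ∃ P : Finset (Finset V),
    IsPartitionOf Finset.univ P ∧ 2 ≤ P.card ∧ t = partitionRate H P}

/-- The restriction of a sum to the blocks of a partition adds up to the whole sum. -/
theorem IsPartitionOf.sum_sum {V : Type*} [DecidableEq V] {W : Finset V}
    {P : Finset (Finset V)} (hP : IsPartitionOf W P) (r : V → ℝ) :
    ∑ X ∈ P, ∑ i ∈ X, r i = ∑ i ∈ W, r i := by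
  rw [← hP.2.2]
  exact (Finset.sum_biUnion (t := id) fun X hX Y hY h => hP.2.1 X hX Y hY h).symm

theorem isPartitionOf_singletons {V : Type*} [Fintype V] [DecidableEq V] :
    IsPartitionOf (univ : Finset V) (univ.image fun i : V => ({i} : Finset V)) := by
  refine ⟨?_, ?_, ?_⟩
  · simp
  · simp only [mem_image, mem_univ, true_and]
    rintro _ ⟨i, rfl⟩ _ ⟨j, rfl⟩ h
    exact disjoint_singleton.2 fun e => h (e ▸ rfl)
  · ext i
    simp

/-- The partition formula is a lower bound for the sum-rate of an achievable rate vector. -/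
theorem MemRCO.partitionRate_le {V : Type*} [Fintype V] [DecidableEq V] {H : Finset V → ℝ}
    {r : V → ℝ} (hr : MemRCO H r) {P : Finset (Finset V)} (hP : IsPartitionOf univ P)
    (hcard : 2 ≤ P.card) : partitionRate H P ≤ ∑ i, r i := by
  have hc : (2 : ℝ) ≤ P.card := by exact_mod_cast hcard
  rw [partitionRate, ← Finset.sum_div, div_le_iff₀ (by linarith)]
  calc ∑ X ∈ P, (H univ - H X) ≤ ∑ X ∈ P, (∑ i, r i - ∑ i ∈ X, r i) := by
        refine Finset.sum_le_sum fun X hX => ?_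
        have h := hr (univ \ X) (Finset.sdiff_ssubset (subset_univ X) (hP.1 X hX))
        rw [Finset.sdiff_sdiff_eq_self (subset_univ X)] at h
        have h' := Finset.sum_sdiff (f := r) (subset_univ X)
        linarith
    _ = (∑ i, r i) * ((P.card : ℝ) - 1) := by
        rw [Finset.sum_sub_distrib, hP.sum_sum r, Finset.sum_const, nsmul_eq_mul]
        ring

/-- The maximum in the partition formula is attained. -/
theorem exists_isGreatest_RACOSet {V : Type*} [Fintype V] [DecidableEq V] (H : Finset V → ℝ)
    (hV : 2 ≤ Fintype.card V) : ∃ α, IsGreatest (RACOSet H) α := by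
  obtain ⟨P, ⟨hP, hc⟩, hmax⟩ := Set.exists_max_image
    {P : Finset (Finset V) | IsPartitionOf univ P ∧ 2 ≤ P.card} (partitionRate H)
    (Set.toFinite _) ⟨_, isPartitionOf_singletons, by
      rwa [card_image_of_injective _ Finset.singleton_injective, card_univ]⟩
  refine ⟨partitionRate H P, ⟨P, hP, hc, rfl⟩, ?_⟩
  rintro _ ⟨Q, hQ, hQc, rfl⟩
  exact hmax Q ⟨hQ, hQc⟩

/-- Greedy algorithm: starting from a vector dominated by `f` on nonempty sets, one may raise its
coordinates until each of them lies in a tight set. -/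
theorem exists_le_forall_mem_tight {V : Type*} [Fintype V] [DecidableEq V] {f : Finset V → ℝ}
    {r₀ : V → ℝ} (h₀ : ∀ Y : Finset V, Y.Nonempty → ∑ i ∈ Y, r₀ i ≤ f Y) (S : Finset V) :
    ∃ r : V → ℝ, (∀ Y : Finset V, Y.Nonempty → ∑ i ∈ Y, r i ≤ f Y) ∧
      ∀ i ∈ S, ∃ T : Finset V, i ∈ T ∧ ∑ j ∈ T, r j = f T := by
  induction S using Finset.induction_on with
  | empty => exact ⟨r₀, h₀, by simp⟩
  | insert i S _ ih =>
    obtain ⟨r, hr, htight⟩ := ih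
    obtain ⟨Y₀, hY₀, hmin⟩ := Finset.exists_min_image
      (univ.filter fun Y : Finset V => i ∈ Y) (fun Y => f Y - ∑ j ∈ Y, r j) ⟨{i}, by simp⟩
    simp only [mem_filter, mem_univ, true_and] at hY₀ hmin
    set δ := f Y₀ - ∑ j ∈ Y₀, r j with hδ
    have hδ0 : 0 ≤ δ := sub_nonneg.2 (hr Y₀ ⟨i, hY₀⟩)
    have hsum : ∀ Y : Finset V,
        ∑ j ∈ Y, (r + Pi.single i δ : V → ℝ) j = ∑ j ∈ Y, r j + if i ∈ Y then δ else 0 := by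
      intro Y
      simp [Finset.sum_add_distrib]
    refine ⟨r + Pi.single i δ, fun Y hY => ?_, fun j hj => ?_⟩
    · rw [hsum]
      split_ifs with hi
      · linarith [hmin Y hi]
      · linarith [hr Y hY]
    · rcases Finset.mem_insert.1 hj with rfl | hj
      · refine ⟨Y₀, hY₀, ?_⟩
        rw [hsum, if_pos hY₀, hδ]
        ring
      · obtain ⟨T, hjT, hT⟩ := htight j hj
        refine ⟨T, hjT, ?_⟩
        rw [hsum]
        split_ifs with hi
        · linarith [hmin T hi]
        · linarith

/-- If `f` is intersecting submodular and dominates `r` on nonempty sets, and every element lies in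
a tight set, then the ground set is partitioned into tight sets. -/
theorem exists_partition_tight {V : Type*} [Fintype V] [DecidableEq V] {f : Finset V → ℝ}
    (hf : ∀ X Y : Finset V, (X ∩ Y).Nonempty → f (X ∩ Y) + f (X ∪ Y) ≤ f X + f Y) {r : V → ℝ}
    (hr : ∀ Y : Finset V, Y.Nonempty → ∑ i ∈ Y, r i ≤ f Y)
    (htight : ∀ i, ∃ T : Finset V, i ∈ T ∧ ∑ j ∈ T, r j = f T) :
    ∃ P : Finset (Finset V), IsPartitionOf univ P ∧ ∀ X ∈ P, ∑ i ∈ X, r i = f X := by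
  have hmax : ∀ i, ∃ T : Finset V, (i ∈ T ∧ ∑ j ∈ T, r j = f T) ∧
      ∀ U : Finset V, i ∈ U → ∑ j ∈ U, r j = f U → T ⊆ U → U = T := by
    intro i
    obtain ⟨T, hT, hTmax⟩ := Set.exists_max_image
      {T : Finset V | i ∈ T ∧ ∑ j ∈ T, r j = f T} Finset.card (Set.toFinite _) (htight i)
    exact ⟨T, hT, fun U hi hU hTU => (eq_of_subset_of_card_le hTU (hTmax U ⟨hi, hU⟩)).symm⟩
  choose T hT hTmax using hmax
  have hunion : ∀ X Y : Finset V, (X ∩ Y).Nonempty → ∑ j ∈ X, r j = f X → ∑ j ∈ Y, r j = f Y →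
      ∑ j ∈ X ∪ Y, r j = f (X ∪ Y) := by
    intro X Y hXY hX hY
    have hne : (X ∪ Y).Nonempty := hXY.mono (inter_subset_union)
    linarith [hf X Y hXY, hr _ hXY, hr _ hne, Finset.sum_union_inter (s₁ := X) (s₂ := Y) (f := r)]
  refine ⟨univ.image T, ⟨?_, ?_, ?_⟩, ?_⟩
  · simp only [mem_image, mem_univ, true_and]
    rintro _ ⟨i, rfl⟩
    exact ⟨i, (hT i).1⟩
  · simp only [mem_image, mem_univ, true_and]
    rintro _ ⟨i, rfl⟩ _ ⟨j, rfl⟩ hij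
    by_contra hd
    have hU := hunion _ _ (not_disjoint_iff_nonempty_inter.1 hd) (hT i).2 (hT j).2
    exact hij ((hTmax i _ (mem_union_left _ (hT i).1) hU subset_union_left).symm.trans
      (hTmax j _ (mem_union_right _ (hT j).1) hU subset_union_right))
  · ext i
    simpa using ⟨i, (hT i).1⟩
  · simp only [mem_image, mem_univ, true_and]
    rintro _ ⟨i, rfl⟩
    exact (hT i).2

/-- Any upper bound of the partition formula is the sum-rate of an achievable rate vector. -/
theorem exists_memRCO_sum_eq {V : Type*} [Fintype V] [DecidableEq V] [Nonempty V]
    {H : Finset V → ℝ} (hH : IsPolymatroid H) {α : ℝ} (hα : α ∈ upperBounds (RACOSet H)) :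
    ∃ r : V → ℝ, MemRCO H r ∧ ∑ i, r i = α := by
  obtain ⟨h0, hmono, hsub⟩ := hH
  obtain ⟨r, hr, htight⟩ := exists_le_forall_mem_tight (f := fun Y => α - H univ + H Y)
    (r₀ := fun _ : V => -|α - H univ|) (fun Y hY => by
      have hc : (1 : ℝ) ≤ Y.card := by exact_mod_cast hY.card_pos
      have hHY : 0 ≤ H Y := h0 ▸ hmono (empty_subset Y)
      rw [Finset.sum_const, nsmul_eq_mul]
      nlinarith [neg_abs_le (α - H univ), abs_nonneg (α - H univ)]) univ
  obtain ⟨P, hP, hPt⟩ := exists_partition_tight (fun X Y _ => by linarith [hsub X Y]) hr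
    fun i => htight i (mem_univ i)
  have hle : ∑ i, r i ≤ α := by linarith [hr univ univ_nonempty]
  have hsum : ∑ i, r i = ∑ X ∈ P, (α - H univ + H X) := by
    rw [← hP.sum_sum r]
    exact Finset.sum_congr rfl hPt
  have hge : α ≤ ∑ i, r i := by
    rcases lt_or_ge P.card 2 with hc | hc
    · have hne : P.Nonempty := by
        rw [nonempty_iff_ne_empty]
        rintro rfl
        exact univ_nonempty.ne_empty (hP.2.2.symm.trans biUnion_empty)
      obtain ⟨X, rfl⟩ := card_eq_one.1 (by have := hne.card_pos; omega : P.card = 1)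
      have hX : X = univ := by simpa using hP.2.2
      rw [hsum, Finset.sum_singleton, hX]
      linarith
    · have hrate : partitionRate H P ≤ α := hα ⟨P, hP, hc, rfl⟩
      have hc' : (2 : ℝ) ≤ P.card := by exact_mod_cast hc
      rw [partitionRate, ← Finset.sum_div, div_le_iff₀ (by linarith), Finset.sum_sub_distrib,
        Finset.sum_const, nsmul_eq_mul] at hrate
      rw [hsum, Finset.sum_add_distrib, Finset.sum_const, nsmul_eq_mul]
      linarith
  have hrα : ∑ i, r i = α := le_antisymm hle hge
  refine ⟨r, fun X hX => ?_, hrα⟩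
  have h := hr (univ \ X) (sdiff_nonempty.2 hX.2)
  have h' := Finset.sum_sdiff (f := r) (subset_univ X)
  linarith

/-- the LP `min{ r(V) : r ∈ R_CO(V) }` attains its minimum, and the
minimum value equals `R_ACO(V) = max_{P : |P| ≥ 2} Σ_{X ∈ P} (H(V) - H(X)) / (|P| - 1)`. -/
theorem minSumRate_eq_partition_formula {V : Type*} [Fintype V] [DecidableEq V]
    (H : Finset V → ℝ) (hV : 2 ≤ Fintype.card V) (hH : IsPolymatroid H) :
    ∃ α : ℝ,
      IsLeast {s : ℝ | ∃ r : V → ℝ, MemRCO H r ∧ ∑ i, r i = s} α ∧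
      IsGreatest (RACOSet H) α := by
  obtain ⟨α, hα⟩ := exists_isGreatest_RACOSet H hV
  have : Nonempty V := Fintype.card_pos_iff.1 (by omega)
  refine ⟨α, ⟨exists_memRCO_sum_eq hH hα.2, ?_⟩, hα⟩
  rintro _ ⟨r, hr, rfl⟩
  obtain ⟨P, hP, hc, rfl⟩ := hα.1
  exact hr.partitionRate_le hP hc
end

section
/- Let V be a finite set with |V| ≥ 2 and H a polymatroid rank function on V. For every achievable rate vector r ∈ R_CO(V) and every partition P of V with |P| ≥ 2, the sum-rate satisfies r(V) ≥ Σ_{X∈P} (H(V) − H(X)) / (|P| − 1). -/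
open Finset

/-- every achievable rate vector has sum-rate at least
`Σ_{X ∈ P} (H(V) - H(X)) / (|P| - 1)` for every partition `P` of `V` with `|P| ≥ 2`. -/
theorem sumRate_ge_partition_bound {V : Type*} [Fintype V] [DecidableEq V]
    (H : Finset V → ℝ) (hV : 2 ≤ Fintype.card V) (hH : IsPolymatroid H)
    (r : V → ℝ) (hr : MemRCO H r)
    (P : Finset (Finset V)) (hP : IsPartitionOf Finset.univ P) (hPcard : 2 ≤ P.card) :
    partitionRate H P ≤ ∑ i, r i := by
  obtain ⟨hne, hdisj, hunion⟩ := hP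
  have hpos : (0 : ℝ) < (P.card : ℝ) - 1 := by
    have : (2 : ℝ) ≤ P.card := by exact_mod_cast hPcard
    linarith
  have hblock : ∀ X ∈ P, H univ - H X ≤ ∑ i, r i - ∑ i ∈ X, r i := by
    intro X hX
    have hproper : univ \ X ⊂ univ := sdiff_ssubset (subset_univ X) (hne X hX)
    have hrate := hr _ hproper
    rw [Finset.sdiff_sdiff_eq_self (subset_univ X)] at hrate
    have hsplit := sum_sdiff (f := r) (subset_univ X)
    linarith
  have hsum : ∑ X ∈ P, ∑ i ∈ X, r i = ∑ i, r i := by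
    rw [← hunion]
    exact (sum_biUnion (t := id) fun X hX Y hY hXY => hdisj X hX Y hY hXY).symm
  rw [partitionRate, ← sum_div, div_le_iff₀ hpos]
  calc ∑ X ∈ P, (H univ - H X)
      ≤ ∑ X ∈ P, (∑ i, r i - ∑ i ∈ X, r i) := sum_le_sum hblock
    _ = (∑ i, r i) * ((P.card : ℝ) - 1) := by
      rw [sum_sub_distrib, hsum, sum_const, nsmul_eq_mul]
      ring
end

section
/- Let V be a finite set with |V| ≥ 2, H a polymatroid rank function on V, and α ∈ ℝ. There exists an achievable rate vector r ∈ R_CO(V) with r(V) = α if and only if α ≥ R_ACO(V), where R_ACO(V) = max over partitions P of V with |P| ≥ 2 of Σ_{X∈P} (H(V) − H(X)) / (|P| − 1). -/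
open Finset

/-- A vector dominated by `f` on nonempty sets can be chosen so that every element of `S` lies in
a tight set. -/
theorem exists_forall_sum_le_and_tight {V : Type*} [Fintype V] [DecidableEq V]
    (f : Finset V → ℝ) (S : Finset V) :
    ∃ r : V → ℝ, (∀ Y : Finset V, Y.Nonempty → ∑ i ∈ Y, r i ≤ f Y) ∧
      ∀ a ∈ S, ∃ T : Finset V, a ∈ T ∧ ∑ i ∈ T, r i = f T := by
  induction S using Finset.induction_on with
  | empty =>
    refine ⟨fun _ => -∑ Y, |f Y|, fun Y hY => ?_, by simp⟩
    have hM : |f Y| ≤ ∑ Z, |f Z| :=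
      Finset.single_le_sum (f := fun Z => |f Z|) (fun _ _ => abs_nonneg _) (Finset.mem_univ Y)
    have hcard : (1 : ℝ) ≤ Y.card := by exact_mod_cast hY.card_pos
    rw [Finset.sum_const, nsmul_eq_mul]
    nlinarith [neg_abs_le (f Y), abs_nonneg (f Y)]
  | insert a S _ ih =>
    obtain ⟨r, hr, hS⟩ := ih
    obtain ⟨T, hT, hmin⟩ := Finset.exists_min_image
      (Finset.univ.filter fun Y : Finset V => a ∈ Y) (fun Y => f Y - ∑ i ∈ Y, r i)
      ⟨{a}, by simp⟩
    simp only [Finset.mem_filter, Finset.mem_univ, true_and] at hT hmin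
    have hsum (Y : Finset V) :
        ∑ i ∈ Y, (r i + if i = a then f T - ∑ j ∈ T, r j else 0) =
          ∑ i ∈ Y, r i + if a ∈ Y then f T - ∑ j ∈ T, r j else 0 := by
      rw [Finset.sum_add_distrib, Finset.sum_ite_eq']
    refine ⟨fun i => r i + if i = a then f T - ∑ j ∈ T, r j else 0, fun Y hY => ?_,
      fun b hb => ?_⟩
    · rw [hsum]
      split_ifs with haY
      · linarith [hmin Y haY]
      · linarith [hr Y hY]
    · rcases Finset.mem_insert.1 hb with rfl | hb
      · exact ⟨T, hT, by rw [hsum, if_pos hT]; ring⟩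
      · obtain ⟨U, hbU, hU⟩ := hS b hb
        refine ⟨U, hbU, ?_⟩
        rw [hsum]
        split_ifs with haU
        · linarith [hmin U haU, hr T ⟨a, hT⟩]
        · linarith

/-- For an intersecting submodular function `f`, some vector dominated by `f` on nonempty sets has
its total mass equal to the value of `f` on a partition. -/
theorem exists_forall_sum_le_and_partition {V : Type*} [Fintype V] [DecidableEq V]
    (f : Finset V → ℝ)
    (hf : ∀ X Y : Finset V, (X ∩ Y).Nonempty → f (X ∩ Y) + f (X ∪ Y) ≤ f X + f Y) :
    ∃ r : V → ℝ, (∀ Y : Finset V, Y.Nonempty → ∑ i ∈ Y, r i ≤ f Y) ∧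
      ∃ P : Finset (Finset V), IsPartitionOf Finset.univ P ∧ ∑ i, r i = ∑ X ∈ P, f X := by
  classical
  obtain ⟨r, hr, htight⟩ := exists_forall_sum_le_and_tight f Finset.univ
  let Tight : Finset V → Prop := fun T => T.Nonempty ∧ ∑ i ∈ T, r i = f T
  have hunion : ∀ X Y, Tight X → Tight Y → (X ∩ Y).Nonempty → Tight (X ∪ Y) := by
    intro X Y hX hY hXY
    refine ⟨hX.1.mono Finset.subset_union_left, ?_⟩
    have hne : (X ∪ Y).Nonempty := hX.1.mono Finset.subset_union_left
    linarith [hf X Y hXY, hr _ hXY, hr _ hne, hX.2, hY.2,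
      Finset.sum_union_inter (s₁ := X) (s₂ := Y) (f := r)]
  let P : Finset (Finset V) := Finset.univ.filter (Maximal Tight)
  have hmem (X : Finset V) : X ∈ P ↔ Maximal Tight X := by simp [P]
  have hP : IsPartitionOf Finset.univ P := by
    refine ⟨fun X hX => ((hmem X).1 hX).prop.1, fun X hX Y hY hXY => ?_, ?_⟩
    · rw [hmem] at hX hY
      by_contra hdisj
      have hU := hunion X Y hX.prop hY.prop (Finset.not_disjoint_iff_nonempty_inter.1 hdisj)
      exact hXY ((hX.eq_of_le hU Finset.subset_union_left).trans
        (hY.eq_of_le hU Finset.subset_union_right).symm)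
    · refine Finset.eq_univ_of_forall fun a => ?_
      obtain ⟨T, haT, hT⟩ := htight a (Finset.mem_univ a)
      obtain ⟨X, hTX, hX⟩ := (Set.toFinite {T | Tight T}).exists_le_maximal
        (show T ∈ {T | Tight T} from ⟨⟨a, haT⟩, hT⟩)
      exact Finset.mem_biUnion.2 ⟨X, (hmem X).2 hX, hTX haT⟩
  refine ⟨r, hr, P, hP, ?_⟩
  rw [← hP.sum_sum r]
  exact Finset.sum_congr rfl fun X hX => ((hmem X).1 hX).prop.2

theorem partitionRate_le_iff {V : Type*} [Fintype V] (H : Finset V → ℝ)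
    {P : Finset (Finset V)} (hP : 2 ≤ P.card) (α : ℝ) :
    partitionRate H P ≤ α ↔
      ∑ X ∈ P, (H Finset.univ - H X) ≤ α * ((P.card : ℝ) - 1) := by
  have hcard : (2 : ℝ) ≤ P.card := by exact_mod_cast hP
  rw [partitionRate, ← Finset.sum_div, div_le_iff₀ (by linarith)]

/-- a sum-rate `α` is achievable iff `α ≥ R_ACO(V)`, where `R_ACO(V)` is the
maximum of the partition formula. -/
theorem achievable_iff_ge_RACO {V : Type*} [Fintype V] [DecidableEq V]
    (H : Finset V → ℝ) (hV : 2 ≤ Fintype.card V) (hH : IsPolymatroid H)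
    (γ : ℝ) (hγ : IsGreatest (RACOSet H) γ) (α : ℝ) :
    (∃ r : V → ℝ, MemRCO H r ∧ ∑ i, r i = α) ↔ γ ≤ α := by
  constructor
  · rintro ⟨r, hr, rfl⟩
    obtain ⟨P, hP, hcard, rfl⟩ := hγ.1
    rw [partitionRate_le_iff H hcard]
    have hblock : ∀ X ∈ P, H Finset.univ - H X ≤ ∑ i, r i - ∑ i ∈ X, r i := by
      intro X hX
      have h := hr (Finset.univ \ X)
        (Finset.sdiff_ssubset (Finset.subset_univ X) (hP.1 X hX))
      rw [Finset.sdiff_sdiff_eq_self (Finset.subset_univ X)] at h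
      linarith [Finset.sum_sdiff (f := r) (Finset.subset_univ X)]
    refine (Finset.sum_le_sum hblock).trans_eq ?_
    rw [Finset.sum_sub_distrib, hP.sum_sum, Finset.sum_const, nsmul_eq_mul]
    ring
  · intro hα
    obtain ⟨r, hr, P, hP, hsum⟩ := exists_forall_sum_le_and_partition
      (fun X => α - H Finset.univ + H X) (fun X Y _ => by linarith [hH.2.2 X Y])
    have hne : (Finset.univ : Finset V).Nonempty :=
      Finset.card_pos.1 (by rw [Finset.card_univ]; omega)
    have hle : ∑ i, r i ≤ α := by linarith [hr Finset.univ hne]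
    have hge : α ≤ ∑ i, r i := by
      rw [hsum]
      rcases Nat.lt_or_ge P.card 2 with hlt | hcard
      · have hPne : P.Nonempty := by
          rw [Finset.nonempty_iff_ne_empty]
          rintro rfl
          exact hne.ne_empty (by simpa using hP.2.2.symm)
        obtain ⟨X, rfl⟩ := Finset.card_eq_one.1 (by have := hPne.card_pos; omega : P.card = 1)
        have hX : X = Finset.univ := by simpa using hP.2.2
        simp [hX]
      · have h := (partitionRate_le_iff H hcard α).1
          ((hγ.2 ⟨P, hP, hcard, rfl⟩).trans hα)
        rw [Finset.sum_sub_distrib, Finset.sum_const, nsmul_eq_mul] at h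
        rw [Finset.sum_add_distrib, Finset.sum_const, nsmul_eq_mul]
        linarith
    have hα' : ∑ i, r i = α := le_antisymm hle hge
    refine ⟨r, fun X hX => ?_, hα'⟩
    have h := hr (Finset.univ \ X) (Finset.sdiff_nonempty.2 hX.2)
    linarith [Finset.sum_sdiff (f := r) (Finset.subset_univ X)]
end

section
/- Let V be a finite nonempty set and g : 2^V → ℝ an intersecting submodular function with g(∅) = 0, i.e., g(X)+g(Y) ≥ g(X∩Y)+g(X∪Y) for all X,Y ⊆ V with X∩Y ≠ ∅. Define the Dilworth truncation ĝ(X) = min over partitions P of X (into nonempty pairwise disjoint parts with union X) of Σ_{Y∈P} g(Y), with ĝ(∅)=0. Then ĝ is (fully) submodular: ĝ(X)+ĝ(Y) ≥ ĝ(X∩Y)+ĝ(X∪Y) for all X,Y ⊆ V. -/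
open Finset

/-- The Dilworth truncation `ĝ(X) = min_{P partition of X} Σ_{Y ∈ P} g(Y)`
(the empty set has the empty partition, so `ĝ(∅) = 0`). -/
noncomputable def dilworth {V : Type*} [DecidableEq V] (g : Finset V → ℝ) (X : Finset V) : ℝ :=
  sInf {s : ℝ | ∃ P : Finset (Finset V), IsPartitionOf X P ∧ s = ∑ Y ∈ P, g Y}

section DilworthTruncation

variable {V : Type*} [DecidableEq V] {g : Finset V → ℝ}

/-- The partition of a set into singletons. -/
lemma isPartitionOf_image_singleton (X : Finset V) :
    IsPartitionOf X (X.image fun x => {x}) := by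
  refine ⟨by simp, ?_, by ext; simp⟩
  simp only [mem_image]
  rintro _ ⟨x, -, rfl⟩ _ ⟨y, -, rfl⟩ h
  exact disjoint_singleton.2 fun hxy => h (by rw [hxy])

lemma IsPartitionOf.union {X Y : Finset V} {P Q : Finset (Finset V)} (hP : IsPartitionOf X P)
    (hQ : IsPartitionOf Y Q) (hXY : Disjoint X Y) : IsPartitionOf (X ∪ Y) (P ∪ Q) := by
  obtain ⟨hP, hP', rfl⟩ := hP
  obtain ⟨hQ, hQ', rfl⟩ := hQ
  have hPQ : ∀ A ∈ P, ∀ B ∈ Q, Disjoint A B := fun A hA B hB =>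
    hXY.mono (subset_biUnion_of_mem id hA) (subset_biUnion_of_mem id hB)
  refine ⟨fun A hA => (mem_union.1 hA).elim (hP A) (hQ A), fun A hA B hB hAB => ?_,
    union_biUnion⟩
  rcases mem_union.1 hA with hA | hA <;> rcases mem_union.1 hB with hB | hB
  · exact hP' A hA B hB hAB
  · exact hPQ A hA B hB
  · exact (hPQ B hB A hA).symm
  · exact hQ' A hA B hB hAB

lemma IsPartitionOf.disjoint {X Y : Finset V} {P Q : Finset (Finset V)} (hP : IsPartitionOf X P)
    (hQ : IsPartitionOf Y Q) (hXY : Disjoint X Y) : Disjoint P Q := by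
  obtain ⟨hP, -, rfl⟩ := hP
  obtain ⟨-, -, rfl⟩ := hQ
  refine disjoint_left.2 fun A hA hA' => (hP A hA).ne_empty (disjoint_self_iff_empty A |>.1 ?_)
  exact hXY.mono (subset_biUnion_of_mem id hA) (subset_biUnion_of_mem id hA')

lemma finite_partition_sums (g : Finset V → ℝ) (X : Finset V) :
    {s : ℝ | ∃ P : Finset (Finset V), IsPartitionOf X P ∧ s = ∑ Y ∈ P, g Y}.Finite := by
  refine (X.powerset.powerset.image fun P => ∑ Y ∈ P, g Y).finite_toSet.subset ?_
  rintro s ⟨P, ⟨-, -, rfl⟩, rfl⟩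
  refine mem_coe.2 (mem_image_of_mem _ (mem_powerset.2 fun A hA => mem_powerset.2 ?_))
  exact subset_biUnion_of_mem id hA

lemma dilworth_le_sum {X : Finset V} {P : Finset (Finset V)} (hP : IsPartitionOf X P) :
    dilworth g X ≤ ∑ Y ∈ P, g Y :=
  csInf_le (finite_partition_sums g X).bddBelow ⟨P, hP, rfl⟩

lemma exists_dilworth_eq_sum (g : Finset V → ℝ) (X : Finset V) :
    ∃ P, IsPartitionOf X P ∧ dilworth g X = ∑ Y ∈ P, g Y :=
  Set.Nonempty.csInf_mem
    (s := {s : ℝ | ∃ P : Finset (Finset V), IsPartitionOf X P ∧ s = ∑ Y ∈ P, g Y})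
    ⟨_, _, isPartitionOf_image_singleton X, rfl⟩ (finite_partition_sums g X)

lemma dilworth_empty_le : dilworth g ∅ ≤ 0 :=
  (dilworth_le_sum (P := ∅) ⟨by simp, by simp, by simp⟩).trans_eq sum_empty

lemma dilworth_le (hg0 : g ∅ = 0) (X : Finset V) : dilworth g X ≤ g X := by
  rcases X.eq_empty_or_nonempty with rfl | hX
  · exact dilworth_empty_le.trans_eq hg0.symm
  · refine (dilworth_le_sum (P := {X}) ⟨by simpa, ?_, by simp⟩).trans_eq (sum_singleton g X)
    simp +contextual

lemma dilworth_union_le {X Y : Finset V} (hXY : Disjoint X Y) :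
    dilworth g (X ∪ Y) ≤ dilworth g X + dilworth g Y := by
  obtain ⟨P, hP, hPX⟩ := exists_dilworth_eq_sum g X
  obtain ⟨Q, hQ, hQY⟩ := exists_dilworth_eq_sum g Y
  rw [hPX, hQY, ← sum_union (hP.disjoint hQ hXY)]
  exact dilworth_le_sum (hP.union hQ hXY)

/-- Uncrossing one set `A` against a family of pairwise disjoint sets. -/
lemma dilworth_inter_add_union_le_add_sum (hg0 : g ∅ = 0)
    (hg : ∀ X Y : Finset V, (X ∩ Y).Nonempty → g (X ∩ Y) + g (X ∪ Y) ≤ g X + g Y)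
    (Q : Finset (Finset V)) (hQ : ∀ B ∈ Q, ∀ C ∈ Q, B ≠ C → Disjoint B C) (A : Finset V) :
    dilworth g (A ∩ Q.biUnion id) + dilworth g (A ∪ Q.biUnion id) ≤ g A + ∑ B ∈ Q, g B := by
  induction Q using Finset.induction_on generalizing A with
  | empty =>
    have := dilworth_le hg0 A
    have := dilworth_empty_le (g := g)
    simp only [biUnion_empty, inter_empty, union_empty, sum_empty]
    linarith
  | insert B Q hB ih =>
    replace ih := ih fun C hC D hD => hQ C (mem_insert_of_mem hC) D (mem_insert_of_mem hD)
    have hBQ : Disjoint B (Q.biUnion id) := (disjoint_biUnion_right _ _ _).2 fun C hC =>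
      hQ B (mem_insert_self B Q) C (mem_insert_of_mem hC) fun h => hB (h ▸ hC)
    rw [biUnion_insert, sum_insert hB, id]
    set U := Q.biUnion id
    rcases (A ∩ B).eq_empty_or_nonempty with hAB | hAB
    · have hdisj : Disjoint B (A ∪ U) :=
        disjoint_union_right.2 ⟨(disjoint_iff_inter_eq_empty.2 hAB).symm, hBQ⟩
      have hunion := dilworth_union_le (g := g) hdisj
      have := dilworth_le hg0 B
      have := ih A
      rw [inter_union_distrib_left, hAB, empty_union, union_left_comm]
      linarith
    · have hdisj : Disjoint (A ∩ B) (A ∩ U) := hBQ.mono inter_subset_right inter_subset_right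
      have hunion := dilworth_union_le (g := g) hdisj
      have := dilworth_le hg0 (A ∩ B)
      have := hg A B hAB
      have hAU := ih (A ∪ B)
      rw [union_inter_distrib_right, disjoint_iff_inter_eq_empty.1 hBQ, union_empty,
        union_assoc] at hAU
      rw [inter_union_distrib_left]
      linarith

lemma dilworth_inter_add_union_le_add (hg0 : g ∅ = 0)
    (hg : ∀ X Y : Finset V, (X ∩ Y).Nonempty → g (X ∩ Y) + g (X ∪ Y) ≤ g X + g Y)
    (A Y : Finset V) : dilworth g (A ∩ Y) + dilworth g (A ∪ Y) ≤ g A + dilworth g Y := by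
  obtain ⟨Q, ⟨-, hQ, rfl⟩, hQY⟩ := exists_dilworth_eq_sum g Y
  rw [hQY]
  exact dilworth_inter_add_union_le_add_sum hg0 hg Q hQ A

lemma dilworth_inter_add_union_le_sum_add (hg0 : g ∅ = 0)
    (hg : ∀ X Y : Finset V, (X ∩ Y).Nonempty → g (X ∩ Y) + g (X ∪ Y) ≤ g X + g Y)
    (P : Finset (Finset V)) (hP : ∀ B ∈ P, ∀ C ∈ P, B ≠ C → Disjoint B C) (Y : Finset V) :
    dilworth g (P.biUnion id ∩ Y) + dilworth g (P.biUnion id ∪ Y) ≤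
      ∑ B ∈ P, g B + dilworth g Y := by
  induction P using Finset.induction_on with
  | empty =>
    have := dilworth_empty_le (g := g)
    simp only [biUnion_empty, empty_inter, empty_union, sum_empty]
    linarith
  | insert A P hA ih =>
    replace ih := ih fun C hC D hD => hP C (mem_insert_of_mem hC) D (mem_insert_of_mem hD)
    have hAP : Disjoint A (P.biUnion id) := (disjoint_biUnion_right _ _ _).2 fun C hC =>
      hP A (mem_insert_self A P) C (mem_insert_of_mem hC) fun h => hA (h ▸ hC)
    rw [biUnion_insert, sum_insert hA, id]
    set U := P.biUnion id
    have hdisj : Disjoint (A ∩ Y) (U ∩ Y) := hAP.mono inter_subset_left inter_subset_left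
    have hunion := dilworth_union_le (g := g) hdisj
    have hAU := dilworth_inter_add_union_le_add hg0 hg A (U ∪ Y)
    rw [inter_union_distrib_left, disjoint_iff_inter_eq_empty.1 hAP, empty_union] at hAU
    rw [union_inter_distrib_right, union_assoc]
    linarith

end DilworthTruncation

/-- the Dilworth truncation of a normalized intersecting submodular
function is (fully) submodular. -/
theorem dilworth_submodular {V : Type*} [Fintype V] [DecidableEq V] [Nonempty V]
    (g : Finset V → ℝ) (hg0 : g ∅ = 0)
    (hg : ∀ X Y : Finset V, (X ∩ Y).Nonempty →
      g (X ∩ Y) + g (X ∪ Y) ≤ g X + g Y) :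
    ∀ X Y : Finset V,
      dilworth g (X ∩ Y) + dilworth g (X ∪ Y) ≤ dilworth g X + dilworth g Y := by
  intro X Y
  obtain ⟨P, ⟨-, hP, rfl⟩, hPX⟩ := exists_dilworth_eq_sum g X
  rw [hPX]
  exact dilworth_inter_add_union_le_sum_add hg0 hg P hP Y
end

section
/- Let V be a finite set with |V| ≥ 2, H a polymatroid rank function on V, and α ∈ ℝ. Then min over partitions P of V of Σ_{X∈P} f^#_α(X) is always at most α, and it equals α if and only if α ≥ R_ACO(V), where R_ACO(V) = max over partitions P of V with |P| ≥ 2 of Σ_{X∈P} (H(V) − H(X)) / (|P| − 1). -/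
open Finset

/-- The dual set function `f^#_α`: `f^#_α(∅) = 0` and
`f^#_α(X) = α - H(V) + H(X)` for nonempty `X`. -/
noncomputable def fhash {V : Type*} [Fintype V] [DecidableEq V] (H : Finset V → ℝ) (α : ℝ)
    (X : Finset V) : ℝ :=
  if X = ∅ then 0 else α - H Finset.univ + H X

/-- On nonempty blocks, `fhash H α` sums to `|P| α` minus the total co-rank of the blocks. -/
lemma sum_fhash_eq {V : Type*} [Fintype V] [DecidableEq V] (H : Finset V → ℝ) (α : ℝ)
    {P : Finset (Finset V)} (hP : ∀ X ∈ P, X.Nonempty) :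
    ∑ X ∈ P, fhash H α X = P.card * α - ∑ X ∈ P, (H Finset.univ - H X) := by
  have h : ∀ X ∈ P, fhash H α X = α - (H Finset.univ - H X) := fun X hX => by
    rw [fhash, if_neg (hP X hX).ne_empty]
    ring
  rw [Finset.sum_congr rfl h, Finset.sum_sub_distrib, Finset.sum_const, nsmul_eq_mul]

/-- For at least two nonempty blocks, the excess of the `fhash` sum over `α` is
`(|P| - 1) (α - partitionRate H P)`. -/
lemma sum_fhash_sub_eq {V : Type*} [Fintype V] [DecidableEq V] (H : Finset V → ℝ) (α : ℝ)
    {P : Finset (Finset V)} (hP : ∀ X ∈ P, X.Nonempty) (hc : 2 ≤ P.card) :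
    ∑ X ∈ P, fhash H α X - α = ((P.card : ℝ) - 1) * (α - partitionRate H P) := by
  have hc' : (2 : ℝ) ≤ P.card := by exact_mod_cast hc
  have hne : (P.card : ℝ) - 1 ≠ 0 := by linarith
  rw [sum_fhash_eq H α hP, partitionRate, ← Finset.sum_div, mul_sub, mul_div_cancel₀ _ hne]
  ring

lemma isPartitionOf_singleton {V : Type*} [DecidableEq V] {W : Finset V} (hW : W.Nonempty) :
    IsPartitionOf W {W} := by
  simp [IsPartitionOf, hW]

/-- A partition of a nonempty set is trivial or has at least two blocks. -/
lemma IsPartitionOf.eq_singleton_or_two_le_card {V : Type*} [DecidableEq V] {W : Finset V}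
    {P : Finset (Finset V)} (hP : IsPartitionOf W P) (hW : W.Nonempty) :
    P = {W} ∨ 2 ≤ P.card := by
  obtain ⟨-, -, hU⟩ := hP
  rcases Nat.lt_or_ge P.card 2 with h | h
  · left
    rcases Finset.card_le_one_iff_subset_singleton (s := P) |>.1 (by omega) with ⟨X, hX⟩
    rcases Finset.subset_singleton_iff.1 hX with rfl | rfl
    · simp at hU
      exact absurd hU.symm hW.ne_empty
    · simp at hU
      rw [hU]
  · exact Or.inr h

/-- `min_{P ∈ Π(V)} f^#_α[P]` exists, is at most `α`, and equals `α`
iff `α ≥ R_ACO(V)`. -/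
theorem dilworth_min_le_alpha_iff {V : Type*} [Fintype V] [DecidableEq V]
    (H : Finset V → ℝ) (hV : 2 ≤ Fintype.card V) (hH : IsPolymatroid H)
    (γ : ℝ) (hγ : IsGreatest (RACOSet H) γ) (α : ℝ) :
    ∃ m : ℝ,
      IsLeast {s : ℝ | ∃ P : Finset (Finset V),
        IsPartitionOf Finset.univ P ∧ s = ∑ X ∈ P, fhash H α X} m ∧
      m ≤ α ∧ (m = α ↔ γ ≤ α) := by
  have : Nonempty V := Fintype.card_pos_iff.1 (by omega)
  have hne : (Finset.univ : Finset V).Nonempty := Finset.univ_nonempty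
  set S : Set ℝ := {s : ℝ | ∃ P : Finset (Finset V),
    IsPartitionOf Finset.univ P ∧ s = ∑ X ∈ P, fhash H α X}
  have hfin : S.Finite :=
    (Set.finite_range fun P : Finset (Finset V) => ∑ X ∈ P, fhash H α X).subset <| by
      rintro s ⟨P, -, rfl⟩
      exact ⟨P, rfl⟩
  have hαS : α ∈ S :=
    ⟨{Finset.univ}, isPartitionOf_singleton hne, by simp [fhash, hne.ne_empty]⟩
  obtain ⟨m, hm⟩ := hfin.exists_minimal ⟨α, hαS⟩
  have hle : IsLeast S m := ⟨hm.1, fun s hs => (le_total m s).elim id fun h => hm.2 hs h⟩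
  refine ⟨m, hle, hle.2 hαS, fun hmα => ?_, fun hγα => le_antisymm (hle.2 hαS) ?_⟩
  · obtain ⟨P, hP, hc, rfl⟩ := hγ.1
    have hmP := hle.2 ⟨P, hP, rfl⟩
    have hc' : (2 : ℝ) ≤ P.card := by exact_mod_cast hc
    have hprod : 0 ≤ ((P.card : ℝ) - 1) * (α - partitionRate H P) := by
      rw [← sum_fhash_sub_eq H α hP.1 hc]
      linarith
    exact sub_nonneg.1 (nonneg_of_mul_nonneg_right hprod (by linarith))
  · obtain ⟨P, hP, rfl⟩ := hle.1
    rcases hP.eq_singleton_or_two_le_card hne with rfl | hc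
    · simp [fhash, hne.ne_empty]
    · have hrate := hγ.2 ⟨P, hP, hc, rfl⟩
      have hc' : (2 : ℝ) ≤ P.card := by exact_mod_cast hc
      rw [← sub_nonneg, sum_fhash_sub_eq H α hP.1 hc]
      exact mul_nonneg (by linarith) (by linarith)
end

section
/- Let V be a finite set with |V| ≥ 2, H a polymatroid rank function on V, and α ∈ ℝ with α > R_ACO(V), where R_ACO(V) = max over partitions P of V with |P| ≥ 2 of Σ_{X∈P} (H(V) − H(X)) / (|P| − 1). Then the single-block partition {V} is the unique minimizer of P ↦ Σ_{X∈P} f^#_α(X) over all partitions P of V; that is, every partition P ≠ {V} satisfies Σ_{X∈P} f^#_α(X) > α. -/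
open Finset

/-- On a partition, the total of `f^#_α` is `|P| α - Σ_{X ∈ P} (H(V) - H(X))`. -/
lemma sum_fhash_of_isPartitionOf {V : Type*} [Fintype V] [DecidableEq V] (H : Finset V → ℝ)
    (α : ℝ) {W : Finset V} {P : Finset (Finset V)} (hP : IsPartitionOf W P) :
    ∑ X ∈ P, fhash H α X = P.card * α - ∑ X ∈ P, (H Finset.univ - H X) := by
  rw [← nsmul_eq_mul, ← Finset.sum_const, ← Finset.sum_sub_distrib]
  refine Finset.sum_congr rfl fun X hX => ?_
  rw [fhash, if_neg (hP.1 X hX).ne_empty]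
  ring

/-- A partition of a nonempty set other than the single-block one has at least two blocks. -/
lemma IsPartitionOf.two_le_card {V : Type*} [DecidableEq V] {W : Finset V}
    {P : Finset (Finset V)} (hP : IsPartitionOf W P) (hW : W.Nonempty) (hne : P ≠ {W}) :
    2 ≤ P.card := by
  have hU := hP.2.2
  by_contra! hlt
  rcases Finset.card_le_one_iff_subset_singleton.mp (Nat.le_of_lt_succ hlt) with ⟨X, hX⟩
  rcases Finset.subset_singleton_iff.mp hX with rfl | rfl
  · exact hW.ne_empty (by simpa using hU.symm)
  · exact hne (by simpa using hU)

/-- for `α > R_ACO(V)`, the partition `{V}` is the unique minimizer of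
`P ↦ Σ_{X ∈ P} f^#_α(X)`: its value is `α` and every other partition has value `> α`. -/
theorem singleton_partition_unique_minimizer {V : Type*} [Fintype V] [DecidableEq V]
    (H : Finset V → ℝ) (hV : 2 ≤ Fintype.card V) (hH : IsPolymatroid H)
    (γ : ℝ) (hγ : IsGreatest (RACOSet H) γ) (α : ℝ) (hα : γ < α) :
    (∑ X ∈ ({Finset.univ} : Finset (Finset V)), fhash H α X = α) ∧
    ∀ P : Finset (Finset V), IsPartitionOf Finset.univ P →
      P ≠ {Finset.univ} → α < ∑ X ∈ P, fhash H α X := by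
  have : Nonempty V := Fintype.card_pos_iff.mp (by omega)
  refine ⟨by simp [fhash, Finset.univ_nonempty.ne_empty], fun P hP hne => ?_⟩
  have hcard := hP.two_le_card Finset.univ_nonempty hne
  have hrate : partitionRate H P < α := (hγ.2 ⟨P, hP, hcard, rfl⟩).trans_lt hα
  have hpos : (0 : ℝ) < (P.card : ℝ) - 1 := by
    have : (2 : ℝ) ≤ P.card := by exact_mod_cast hcard
    linarith
  rw [partitionRate, ← Finset.sum_div, div_lt_iff₀ hpos] at hrate
  rw [sum_fhash_of_isPartitionOf H α hP]
  linarith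
end

section
/- Let V be a finite set with |V| ≥ 2, H a polymatroid rank function on V, and α ∈ ℝ with α < R_ACO(V), where R_ACO(V) = max over partitions P of V with |P| ≥ 2 of Σ_{X∈P} (H(V) − H(X)) / (|P| − 1). Then every minimizer P* of P ↦ Σ_{X∈P} f^#_α(X) over partitions P of V satisfies |P*| ≥ 2 and α < Σ_{X∈P*} (H(V) − H(X)) / (|P*| − 1) ≤ R_ACO(V). (Hence the sum-rate estimation update of the MDA algorithm strictly increases and never exceeds R_ACO(V).) -/
open Finset

lemma IsPartitionOf.sum_fhash {V : Type*} [Fintype V] [DecidableEq V] {W : Finset V}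
    {P : Finset (Finset V)} (hP : IsPartitionOf W P) (H : Finset V → ℝ) (α : ℝ) :
    ∑ X ∈ P, fhash H α X = P.card * α - ∑ X ∈ P, (H Finset.univ - H X) := by
  rw [← nsmul_eq_mul, ← Finset.sum_const, ← Finset.sum_sub_distrib]
  refine Finset.sum_congr rfl fun X hX => ?_
  rw [fhash, if_neg (hP.1 X hX).ne_empty]
  ring

lemma IsPartitionOf.lt_partitionRate_iff {V : Type*} [Fintype V] [DecidableEq V] {W : Finset V}
    {P : Finset (Finset V)} (hP : IsPartitionOf W P) (hcard : 2 ≤ P.card)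
    (H : Finset V → ℝ) (α : ℝ) :
    α < partitionRate H P ↔ ∑ X ∈ P, fhash H α X < α := by
  have h2 : (2 : ℝ) ≤ P.card := by exact_mod_cast hcard
  rw [hP.sum_fhash, partitionRate, ← Finset.sum_div, lt_div_iff₀ (by linarith)]
  constructor <;> intro h <;> linarith

lemma IsPartitionOf.two_le_card_s8 {V : Type*} [Fintype V] [DecidableEq V] [Nonempty V]
    {P : Finset (Finset V)} (hP : IsPartitionOf Finset.univ P) {H : Finset V → ℝ} {α : ℝ}
    (h : ∑ X ∈ P, fhash H α X < α) : 2 ≤ P.card := by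
  by_contra! hlt
  have hunion := hP.2.2
  interval_cases hc : P.card
  · rw [Finset.card_eq_zero.mp hc, Finset.biUnion_empty] at hunion
    exact Finset.univ_nonempty.ne_empty hunion.symm
  · obtain ⟨X, rfl⟩ := Finset.card_eq_one.mp hc
    rw [Finset.singleton_biUnion, id] at hunion
    rw [hP.sum_fhash, hunion] at h
    simp at h

/-- for `α < R_ACO(V)`, every minimizer `P*` of `P ↦ Σ_{X ∈ P} f^#_α(X)`
has `|P*| ≥ 2` and `α < Σ_{X ∈ P*} (H(V) - H(X)) / (|P*| - 1) ≤ R_ACO(V)`. -/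
theorem MDA_update_strictly_increases {V : Type*} [Fintype V] [DecidableEq V]
    (H : Finset V → ℝ) (hV : 2 ≤ Fintype.card V) (hH : IsPolymatroid H)
    (γ : ℝ) (hγ : IsGreatest (RACOSet H) γ) (α : ℝ) (hα : α < γ) :
    ∀ P : Finset (Finset V), IsPartitionOf Finset.univ P →
      (∀ Q : Finset (Finset V), IsPartitionOf Finset.univ Q →
        ∑ X ∈ P, fhash H α X ≤ ∑ X ∈ Q, fhash H α X) →
      2 ≤ P.card ∧ α < partitionRate H P ∧ partitionRate H P ≤ γ := by
  intro P hP hmin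
  obtain ⟨⟨Q, hQ, hQcard, rfl⟩, hub⟩ := hγ
  have : Nonempty V := Fintype.card_pos_iff.mp (by lia)
  have hlt : ∑ X ∈ P, fhash H α X < α :=
    (hmin Q hQ).trans_lt ((hQ.lt_partitionRate_iff hQcard H α).mp hα)
  have hcard := hP.two_le_card_s8 hlt
  exact ⟨hcard, (hP.lt_partitionRate_iff hcard H α).mpr hlt, hub ⟨P, hP, hcard, rfl⟩⟩
end

section
/- Let V be a finite set with |V| ≥ 2, H a polymatroid rank function on V, and α ∈ ℝ. Let W ⊊ V, let P* be a partition of W, and let φ ∈ V ∖ W. Let r ∈ ℝ^V satisfy r(Z) ≤ f^#_α(Z) for all Z ⊆ V and r(Y) = f^#_α(Y) for every block Y ∈ P*. Then for every X with φ ∈ X ⊆ W ∪ {φ}, letting 𝒴 = { Y ∈ P* : Y ∩ X ≠ ∅ } and Ỹ = ∪_{Y∈𝒴} Y, one has f^#_α(X) − r(X) ≥ f^#_α({φ} ∪ Ỹ) − r({φ} ∪ Ỹ). -/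
open Finset

/-- Submodularity of `fhash` on intersecting pairs. -/
theorem fhash_inter_add_union_le {V : Type*} [Fintype V] [DecidableEq V] {H : Finset V → ℝ}
    (hH : IsPolymatroid H) (α : ℝ) {X Y : Finset V} (hXY : (X ∩ Y).Nonempty) :
    fhash H α (X ∩ Y) + fhash H α (X ∪ Y) ≤ fhash H α X + fhash H α Y := by
  have hX : X.Nonempty := hXY.mono inter_subset_left
  have hY : Y.Nonempty := hXY.mono inter_subset_right
  have hU : (X ∪ Y).Nonempty := hX.mono subset_union_left
  simp only [fhash, hXY.ne_empty, hX.ne_empty, hY.ne_empty, hU.ne_empty, if_false]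
  linarith [hH.2.2 X Y]

/-- Adding tight sets that meet `X` does not increase the slack of `X`. -/
theorem fhash_sub_sum_union_biUnion_le {V : Type*} [Fintype V] [DecidableEq V]
    {H : Finset V → ℝ} (hH : IsPolymatroid H) {α : ℝ} {r : V → ℝ}
    (hr : ∀ Z : Finset V, ∑ i ∈ Z, r i ≤ fhash H α Z) (X : Finset V) (Q : Finset (Finset V))
    (hQ : ∀ Y ∈ Q, ∑ i ∈ Y, r i = fhash H α Y ∧ (Y ∩ X).Nonempty) :
    fhash H α (X ∪ Q.biUnion id) - ∑ i ∈ X ∪ Q.biUnion id, r i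
      ≤ fhash H α X - ∑ i ∈ X, r i := by
  induction Q using Finset.induction_on with
  | empty => simp
  | insert Y Q _ ih =>
    have ih' := ih fun Z hZ => hQ Z (mem_insert_of_mem hZ)
    obtain ⟨hY, hYX⟩ := hQ Y (mem_insert_self Y Q)
    have hunion : X ∪ (insert Y Q).biUnion id = (X ∪ Q.biUnion id) ∪ Y := by
      rw [biUnion_insert, id, union_comm Y, union_assoc]
    rw [hunion]
    have hmeet : ((X ∪ Q.biUnion id) ∩ Y).Nonempty := by
      rw [inter_comm] at hYX
      exact hYX.mono (inter_subset_inter_right subset_union_left)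
    linarith [fhash_inter_add_union_le hH α hmeet, hr ((X ∪ Q.biUnion id) ∩ Y),
      sum_union_inter (s₁ := X ∪ Q.biUnion id) (s₂ := Y) (f := r)]

/-- for any `X` with `φ ∈ X ⊆ W ∪ {φ}`, fusing the blocks of `P*` that
meet `X` can only decrease `f^#_α(⋅) - r(⋅)`. -/
theorem fusion_decreases_saturation {V : Type*} [Fintype V] [DecidableEq V]
    (H : Finset V → ℝ) (hV : 2 ≤ Fintype.card V) (hH : IsPolymatroid H) (α : ℝ)
    (W : Finset V) (hW : W ⊂ Finset.univ)
    (Pstar : Finset (Finset V)) (hPstar : IsPartitionOf W Pstar)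
    (φ : V) (hφ : φ ∉ W) (r : V → ℝ)
    (hr₁ : ∀ Z : Finset V, ∑ i ∈ Z, r i ≤ fhash H α Z)
    (hr₂ : ∀ Y ∈ Pstar, ∑ i ∈ Y, r i = fhash H α Y) :
    ∀ X : Finset V, φ ∈ X → X ⊆ insert φ W →
      fhash H α (insert φ ((Pstar.filter fun Y => (Y ∩ X).Nonempty).biUnion id))
          - ∑ i ∈ insert φ ((Pstar.filter fun Y => (Y ∩ X).Nonempty).biUnion id), r i
        ≤ fhash H α X - ∑ i ∈ X, r i := by
  intro X hφX hXW
  have hcover : insert φ ((Pstar.filter fun Y => (Y ∩ X).Nonempty).biUnion id)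
      = X ∪ (Pstar.filter fun Y => (Y ∩ X).Nonempty).biUnion id := by
    refine Subset.antisymm
      (insert_subset (mem_union_left _ hφX) subset_union_right)
      (union_subset (fun x hx => ?_) (subset_insert _ _))
    rcases mem_insert.1 (hXW hx) with rfl | hxW
    · exact mem_insert_self _ _
    · rw [← hPstar.2.2] at hxW
      obtain ⟨Y, hY, hxY⟩ := mem_biUnion.1 hxW
      exact mem_insert_of_mem (mem_biUnion.2
        ⟨Y, mem_filter.2 ⟨hY, x, mem_inter.2 ⟨hxY, hx⟩⟩, hxY⟩)
  rw [hcover]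
  refine fhash_sub_sum_union_biUnion_le hH hr₁ X _ fun Y hY => ?_
  exact ⟨hr₂ Y (mem_filter.1 hY).1, (mem_filter.1 hY).2⟩
end

section
/- Let V be a finite set with |V| ≥ 2, H a polymatroid rank function on V, and α ∈ ℝ. Let W ⊆ V, φ ∈ W, and let r ∈ ℝ^V satisfy r_j ≤ 0 for all j ∈ V ∖ W. Then min{ f^#_α(X) − r(X) : φ ∈ X ⊆ V } = min{ f^#_α(X) − r(X) : φ ∈ X ⊆ W }; that is, by monotonicity of H the minimization of the saturation capacity can be restricted to subsets of the already-processed users. -/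
open Finset

/-- Intersecting with `W` does not increase `f^#_α(X) - r(X)` when `r ≤ 0` off `W`. -/
theorem fhash_inter_sub_sum_le {V : Type*} [Fintype V] [DecidableEq V]
    {H : Finset V → ℝ} (hH : ∀ ⦃X Y : Finset V⦄, Y ⊆ X → H Y ≤ H X) (α : ℝ)
    {W X : Finset V} (hXW : (X ∩ W).Nonempty) {r : V → ℝ}
    (hr : ∀ j : V, j ∉ W → r j ≤ 0) :
    fhash H α (X ∩ W) - ∑ i ∈ X ∩ W, r i ≤ fhash H α X - ∑ i ∈ X, r i := by
  have hX : X.Nonempty := hXW.mono inter_subset_left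
  have hmono : H (X ∩ W) ≤ H X := hH inter_subset_left
  have hsum : ∑ i ∈ X, r i ≤ ∑ i ∈ X ∩ W, r i := by
    rw [← sum_inter_add_sum_sdiff X W r]
    have : ∑ i ∈ X \ W, r i ≤ 0 := sum_nonpos fun j hj => hr j (mem_sdiff.1 hj).2
    linarith
  simp only [fhash, hXW.ne_empty, hX.ne_empty, if_false]
  linarith

/-- if `r_j ≤ 0` for every `j ∉ W`, the saturation capacity minimization
over all `X` with `φ ∈ X ⊆ V` can be restricted to `φ ∈ X ⊆ W`. -/
theorem saturation_capacity_restrict {V : Type*} [Fintype V] [DecidableEq V]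
    (H : Finset V → ℝ) (hV : 2 ≤ Fintype.card V) (hH : IsPolymatroid H) (α : ℝ)
    (W : Finset V) (φ : V) (hφ : φ ∈ W) (r : V → ℝ)
    (hr : ∀ j : V, j ∉ W → r j ≤ 0) :
    sInf {s : ℝ | ∃ X : Finset V, φ ∈ X ∧ s = fhash H α X - ∑ i ∈ X, r i}
      = sInf {s : ℝ | ∃ X : Finset V, φ ∈ X ∧ X ⊆ W ∧
          s = fhash H α X - ∑ i ∈ X, r i} := by
  apply le_antisymm
  · refine csInf_le_csInf ?_ ⟨_, {φ}, mem_singleton_self φ, singleton_subset_iff.2 hφ, rfl⟩ ?_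
    · exact ((Set.finite_range fun X : Finset V => fhash H α X - ∑ i ∈ X, r i).subset
        (by rintro _ ⟨X, -, rfl⟩; exact ⟨X, rfl⟩)).bddBelow
    · rintro _ ⟨X, hX, -, rfl⟩
      exact ⟨X, hX, rfl⟩
  · refine le_csInf ⟨_, {φ}, mem_singleton_self φ, rfl⟩ ?_
    rintro _ ⟨X, hX, rfl⟩
    have hmem : φ ∈ X ∩ W := mem_inter.2 ⟨hX, hφ⟩
    refine le_trans (csInf_le ?_ ⟨X ∩ W, hmem, inter_subset_right, rfl⟩)
      (fhash_inter_sub_sum_le hH.2.1 α ⟨φ, hmem⟩ hr)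
    exact ((Set.finite_range fun X : Finset V => fhash H α X - ∑ i ∈ X, r i).subset
      (by rintro _ ⟨X, -, -, rfl⟩; exact ⟨X, rfl⟩)).bddBelow
end

section
/- Let V be a finite nonempty set and g : 2^V → ℤ a submodular function with g(∅) = 0 (g(X)+g(Y) ≥ g(X∩Y)+g(X∪Y) for all X,Y ⊆ V). Every extreme point of the base polyhedron B(g) = { x ∈ ℝ^V : Σ_{i∈X} x_i ≤ g(X) for all X ⊆ V, Σ_{i∈V} x_i = g(V) } has all coordinates in ℤ. -/
open Finset

/-- Sets on which a point of the base polyhedron attains its bound are closed under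
intersection and union. -/
theorem tight_inter_union {V : Type*} [DecidableEq V] {g : Finset V → ℤ}
    (hg : ∀ X Y : Finset V, g (X ∩ Y) + g (X ∪ Y) ≤ g X + g Y)
    {x : V → ℝ} (hx : ∀ X : Finset V, ∑ i ∈ X, x i ≤ (g X : ℝ)) {X Y : Finset V}
    (hX : ∑ i ∈ X, x i = g X) (hY : ∑ i ∈ Y, x i = g Y) :
    ∑ i ∈ X ∩ Y, x i = g (X ∩ Y) ∧ ∑ i ∈ X ∪ Y, x i = g (X ∪ Y) := by
  have hsub : (g (X ∩ Y) : ℝ) + g (X ∪ Y) ≤ g X + g Y := mod_cast hg X Y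
  have hsum := sum_union_inter (s₁ := X) (s₂ := Y) (f := x)
  have hinter := hx (X ∩ Y)
  have hunion := hx (X ∪ Y)
  constructor <;> linarith

/-- A finite family of upper bounds admits a common positive slack on its strict members. -/
theorem exists_pos_slack {ι : Type*} [Finite ι] (a b : ι → ℝ) :
    ∃ ε > 0, ∀ k, a k < b k → a k + ε ≤ b k := by
  have h : ∀ᶠ ε : ℝ in nhdsWithin 0 (Set.Ioi 0), ∀ k, a k < b k → a k + ε ≤ b k := by
    refine Filter.eventually_all.2 fun k => ?_
    by_cases hk : a k < b k
    · filter_upwards [Ioo_mem_nhdsGT (sub_pos.2 hk)] with ε hε _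
      linarith [hε.2]
    · exact Filter.Eventually.of_forall fun _ h => absurd h hk
  obtain ⟨ε, hε, hpos⟩ := (h.and self_mem_nhdsWithin).exists
  exact ⟨ε, hpos, hε⟩

/-- Any two distinct elements are separated by a tight set of an extreme point. -/
theorem exists_tight_separating {V : Type*} [Fintype V] [DecidableEq V] {g : Finset V → ℤ}
    {x : V → ℝ}
    (hx : x ∈ Set.extremePoints ℝ
      {y : V → ℝ | (∀ X : Finset V, ∑ i ∈ X, y i ≤ (g X : ℝ)) ∧
        ∑ i, y i = (g Finset.univ : ℝ)})
    {i j : V} (hij : i ≠ j) :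
    ∃ T : Finset V, ∑ k ∈ T, x k = g T ∧ ¬(i ∈ T ↔ j ∈ T) := by
  by_contra! hsep
  obtain ⟨⟨hle, huniv⟩, hext⟩ := hx
  obtain ⟨ε, hε, hslack⟩ :=
    exists_pos_slack (fun X : Finset V => ∑ k ∈ X, x k) (fun X => (g X : ℝ))
  have hmem : ∀ δ : ℝ, |δ| ≤ ε → x + (Pi.single i δ - Pi.single j δ) ∈
      {y : V → ℝ | (∀ X : Finset V, ∑ i ∈ X, y i ≤ (g X : ℝ)) ∧
        ∑ i, y i = (g Finset.univ : ℝ)} := by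
    intro δ hδ
    obtain ⟨hδl, hδu⟩ := abs_le.1 hδ
    have hsum : ∀ X : Finset V, ∑ k ∈ X, (x + (Pi.single i δ - Pi.single j δ) : V → ℝ) k =
        ∑ k ∈ X, x k + ((if i ∈ X then δ else 0) - if j ∈ X then δ else 0) := by
      intro X
      simp only [Pi.add_apply, Pi.sub_apply, sum_add_distrib, sum_sub_distrib, sum_pi_single']
    refine ⟨fun X => ?_, ?_⟩
    · rw [hsum]
      rcases (hle X).eq_or_lt with hX | hX
      · simp [hsep X hX, hX]
      · have := hslack X hX
        split_ifs <;> linarith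
    · rw [hsum]
      simp [huniv]
  have hx_eq := hext (hmem ε (abs_of_pos hε).le) (hmem (-ε) (by rw [abs_neg, abs_of_pos hε]))
    ⟨1 / 2, 1 / 2, by norm_num, by norm_num, by norm_num, by
      ext k
      simp only [Pi.add_apply, Pi.sub_apply, Pi.smul_apply, Pi.single_neg, Pi.neg_apply,
        smul_eq_mul]
      ring⟩
  have hi := congrFun hx_eq i
  simp [hij] at hi
  exact hε.ne hi.symm

/-- every extreme point of the base polyhedron of an integer-valued
normalized submodular function is integral. -/
theorem extreme_points_integral {V : Type*} [Fintype V] [DecidableEq V] [Nonempty V]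
    (g : Finset V → ℤ) (hg0 : g ∅ = 0)
    (hg : ∀ X Y : Finset V, g (X ∩ Y) + g (X ∪ Y) ≤ g X + g Y) :
    ∀ x ∈ Set.extremePoints ℝ
      {y : V → ℝ | (∀ X : Finset V, ∑ i ∈ X, y i ≤ (g X : ℝ)) ∧
        ∑ i, y i = (g Finset.univ : ℝ)},
      ∀ i : V, ∃ n : ℤ, x i = (n : ℝ) := by
  classical
  intro x hx i
  obtain ⟨hle, huniv⟩ := hx.1
  -- `D` is the least tight set containing `i`.
  obtain ⟨D, hD, hiD, hDmin⟩ : ∃ D : Finset V, ∑ k ∈ D, x k = g D ∧ i ∈ D ∧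
      ∀ T : Finset V, ∑ k ∈ T, x k = g T → i ∈ T → D ⊆ T := by
    let S : Finset (Finset V) := {T | ∑ k ∈ T, x k = g T ∧ i ∈ T}
    have hS : ∑ k ∈ S.inf id, x k = g (S.inf id) ∧ i ∈ S.inf id :=
      inf_induction (p := fun T : Finset V => ∑ k ∈ T, x k = g T ∧ i ∈ T)
        ⟨huniv, mem_univ i⟩
        (fun _ hX _ hY => ⟨(tight_inter_union hg hle hX.1 hY.1).1, mem_inter.2 ⟨hX.2, hY.2⟩⟩)
        (fun T hT => (mem_filter.1 hT).2)
    exact ⟨S.inf id, hS.1, hS.2, fun T hT hiT =>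
      inf_le (f := id) (mem_filter.2 ⟨mem_univ T, hT, hiT⟩)⟩
  -- The tight subsets of `D.erase i` cover it, so it is itself tight.
  have hE : ∑ k ∈ D.erase i, x k = g (D.erase i) := by
    let S : Finset (Finset V) := {T | ∑ k ∈ T, x k = g T ∧ T ⊆ D.erase i}
    have hS : ∑ k ∈ S.sup id, x k = g (S.sup id) ∧ S.sup id ⊆ D.erase i :=
      sup_induction (p := fun T : Finset V => ∑ k ∈ T, x k = g T ∧ T ⊆ D.erase i)
        ⟨by simp [hg0], empty_subset _⟩
        (fun _ hX _ hY => ⟨(tight_inter_union hg hle hX.1 hY.1).2, union_subset hX.2 hY.2⟩)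
        (fun T hT => (mem_filter.1 hT).2)
    suffices hcover : D.erase i ⊆ S.sup id by
      rw [subset_antisymm hcover hS.2]
      exact hS.1
    intro j hj
    obtain ⟨hji, hjD⟩ := mem_erase.1 hj
    obtain ⟨T, hT, hsep⟩ := exists_tight_separating hx hji.symm
    have hiT : i ∉ T := fun hiT => hsep (iff_of_true hiT (hDmin T hT hiT hjD))
    have hjT : j ∈ T := by tauto
    have hTS : T ∩ D ∈ S := mem_filter.2 ⟨mem_univ _, (tight_inter_union hg hle hT hD).1,
      subset_erase.2 ⟨inter_subset_right, fun h => hiT (mem_inter.1 h).1⟩⟩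
    exact le_sup (f := id) hTS (mem_inter.2 ⟨hjT, hjD⟩)
  refine ⟨g D - g (D.erase i), ?_⟩
  have hsum := add_sum_erase D x hiD
  push_cast
  linarith
end

section
/- Let V be a finite nonempty set with |V| = n, g : 2^V → ℝ a submodular function with g(∅) = 0, and φ = (φ_1, …, φ_n) a linear ordering (enumeration) of V; write V_i = {φ_1, …, φ_i} with V_0 = ∅. Define the greedy vector x ∈ ℝ^V by x_{φ_i} = g(V_i) − g(V_{i−1}). Then x lies in the base polyhedron B(g) = { y ∈ ℝ^V : y(X) ≤ g(X) for all X ⊆ V, y(V) = g(V) }, and for any weight vector w ∈ ℝ^V with w_{φ_1} ≤ w_{φ_2} ≤ … ≤ w_{φ_n}, the greedy vector minimizes the weighted sum: Σ_{i∈V} w_i x_i ≤ Σ_{i∈V} w_i y_i for every y ∈ B(g). -/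
open Finset

/-- The set of the first `k` elements `{φ_1, …, φ_k}` of the linear ordering `φ`. -/
def seg {V : Type*} [Fintype V] [DecidableEq V] (φ : Fin (Fintype.card V) ≃ V)
    (k : ℕ) : Finset V :=
  (Finset.univ.filter fun j : Fin (Fintype.card V) => (j : ℕ) < k).image φ

section Seg

variable {V : Type*} [Fintype V] [DecidableEq V] (φ : Fin (Fintype.card V) ≃ V)

lemma mem_seg {k : ℕ} {v : V} : v ∈ seg φ k ↔ (φ.symm v : ℕ) < k := by
  simp only [seg, mem_image, mem_filter, mem_univ, true_and]
  constructor
  · rintro ⟨j, hj, rfl⟩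
    simpa using hj
  · intro h
    exact ⟨φ.symm v, h, by simp⟩

lemma seg_zero : seg φ 0 = ∅ := by
  ext v
  simp [mem_seg]

lemma seg_card : seg φ (Fintype.card V) = univ := by
  ext v
  simp [mem_seg]

lemma notMem_seg_self (j : Fin (Fintype.card V)) : φ j ∉ seg φ j := by
  simp [mem_seg]

lemma seg_succ (j : Fin (Fintype.card V)) : seg φ (j + 1) = insert (φ j) (seg φ j) := by
  ext v
  rw [mem_insert, mem_seg, mem_seg, ← Equiv.symm_apply_eq, Fin.ext_iff]
  omega

/-- Induction along the initial segments of the ordering `φ`. -/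
lemma seg_induction {P : Finset V → Prop} (zero : P ∅)
    (succ : ∀ j : Fin (Fintype.card V), P (seg φ j) → P (insert (φ j) (seg φ j)))
    {k : ℕ} (hk : k ≤ Fintype.card V) : P (seg φ k) := by
  induction k with
  | zero => rwa [seg_zero]
  | succ k ih =>
    have h := succ ⟨k, hk⟩ (ih (by omega))
    rwa [← seg_succ] at h

variable {g : Finset V → ℝ} {x : V → ℝ}

lemma sum_seg_greedy (hg0 : g ∅ = 0)
    (hx : ∀ j, x (φ j) = g (insert (φ j) (seg φ j)) - g (seg φ j))
    {k : ℕ} (hk : k ≤ Fintype.card V) : ∑ i ∈ seg φ k, x i = g (seg φ k) := by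
  refine seg_induction φ (P := fun S => ∑ i ∈ S, x i = g S) (by simp [hg0]) (fun j ih => ?_) hk
  rw [sum_insert (notMem_seg_self φ j), ih, hx]
  ring

lemma sum_inter_seg_greedy_le (hg0 : g ∅ = 0)
    (hg : ∀ X Y : Finset V, g (X ∩ Y) + g (X ∪ Y) ≤ g X + g Y)
    (hx : ∀ j, x (φ j) = g (insert (φ j) (seg φ j)) - g (seg φ j))
    (X : Finset V) {k : ℕ} (hk : k ≤ Fintype.card V) :
    ∑ i ∈ X ∩ seg φ k, x i ≤ g (X ∩ seg φ k) := by
  refine seg_induction φ (P := fun S => ∑ i ∈ X ∩ S, x i ≤ g (X ∩ S)) (by simp [hg0])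
    (fun j ih => ?_) hk
  have hj := notMem_seg_self φ j
  by_cases hX : φ j ∈ X
  · have hsub := hg (insert (φ j) (X ∩ seg φ j)) (seg φ j)
    have hinter : insert (φ j) (X ∩ seg φ j) ∩ seg φ j = X ∩ seg φ j := by
      rw [insert_inter_of_notMem hj, inter_assoc, inter_self]
    have hunion : insert (φ j) (X ∩ seg φ j) ∪ seg φ j = insert (φ j) (seg φ j) := by
      rw [insert_union, union_eq_right.2 inter_subset_right]
    rw [hinter, hunion] at hsub
    rw [inter_insert_of_mem hX, sum_insert (fun h => hj (mem_inter.1 h).2), hx]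
    linarith
  · rwa [inter_insert_of_notMem hX]

/-- Abel summation inequality: if the partial sums of `d` along `φ` are nonpositive and `w` is
nondecreasing along `φ`, then replacing `w` by an upper bound decreases the weighted sum. -/
lemma mul_sum_seg_le_sum_seg_mul {w d : V → ℝ}
    (hw : ∀ j k : Fin (Fintype.card V), j ≤ k → w (φ j) ≤ w (φ k))
    (hd : ∀ k, k ≤ Fintype.card V → ∑ i ∈ seg φ k, d i ≤ 0)
    {k : ℕ} (hk : k ≤ Fintype.card V) {c : ℝ} (hc : ∀ v ∈ seg φ k, w v ≤ c) :
    c * ∑ i ∈ seg φ k, d i ≤ ∑ i ∈ seg φ k, w i * d i := by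
  revert c
  refine seg_induction φ
    (P := fun S => ∀ {c : ℝ}, (∀ v ∈ S, w v ≤ c) → c * ∑ i ∈ S, d i ≤ ∑ i ∈ S, w i * d i)
    (by simp) (fun j ih c hc => ?_) hk
  have hprev := ih (c := w (φ j)) fun v hv => by
    simpa using hw (φ.symm v) j ((mem_seg φ).1 hv).le
  have hneg := hd (j + 1) j.isLt
  rw [seg_succ] at hneg
  have hmul := mul_le_mul_of_nonpos_right (hc (φ j) (mem_insert_self _ _)) hneg
  rw [sum_insert (notMem_seg_self φ j)] at hmul ⊢
  rw [sum_insert (notMem_seg_self φ j)]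
  linarith

end Seg

/-- the greedy vector `x_{φ_i} = g(V_i) - g(V_{i-1})` lies in the base
polyhedron `B(g)`, and minimizes `Σ w_i x_i` over `B(g)` for any weight `w` that is
nondecreasing along the ordering `φ`. -/
theorem greedy_in_base_polyhedron_and_optimal {V : Type*} [Fintype V] [DecidableEq V]
    [Nonempty V] (g : Finset V → ℝ) (hg0 : g ∅ = 0)
    (hg : ∀ X Y : Finset V, g (X ∩ Y) + g (X ∪ Y) ≤ g X + g Y)
    (φ : Fin (Fintype.card V) ≃ V) (x : V → ℝ)
    (hx : ∀ v : V, x v = g (seg φ ((φ.symm v : ℕ) + 1)) - g (seg φ (φ.symm v : ℕ))) :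
    ((∀ X : Finset V, ∑ i ∈ X, x i ≤ g X) ∧ ∑ i, x i = g Finset.univ) ∧
    ∀ w : V → ℝ,
      (∀ j k : Fin (Fintype.card V), j ≤ k → w (φ j) ≤ w (φ k)) →
      ∀ y : V → ℝ,
        ((∀ X : Finset V, ∑ i ∈ X, y i ≤ g X) ∧ ∑ i, y i = g Finset.univ) →
        ∑ i, w i * x i ≤ ∑ i, w i * y i := by
  have hx' : ∀ j, x (φ j) = g (insert (φ j) (seg φ j)) - g (seg φ j) := fun j => by
    rw [hx, Equiv.symm_apply_apply, seg_succ]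
  have hxV : ∑ i, x i = g univ := by
    simpa [seg_card] using sum_seg_greedy φ hg0 hx' le_rfl
  refine ⟨⟨fun X => ?_, hxV⟩, ?_⟩
  · simpa [seg_card] using sum_inter_seg_greedy_le φ hg0 hg hx' X le_rfl
  · rintro w hw y ⟨hy, hyV⟩
    obtain ⟨c, hc⟩ := (Set.finite_range w).bddAbove
    have key := mul_sum_seg_le_sum_seg_mul φ (d := fun i => y i - x i) hw
      (fun k hk => by
        rw [sum_sub_distrib, sum_seg_greedy φ hg0 hx' hk]
        linarith [hy (seg φ k)])
      le_rfl (c := c) (fun v _ => hc ⟨v, rfl⟩)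
    simp only [seg_card, mul_sub, sum_sub_distrib, hxV, hyV, sub_self] at key
    linarith
end
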